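/- Let E be a locally compact Polish space, Q a jointly weakly continuous transition function, and α ∈ (0,1). Then for every bounded continuous F : E → ℝ the series U_α(s,t)F(x) := Σ_{n≥0} αⁿ U⁽ⁿ⁾(s,t)F(x) converges uniformly in (s,t,x), and the map (s,t,x) ↦ U_α(s,t)F(x) is continuous on {(s,t) : 0 ≤ s ≤ t} × E; that is, the regularized evolution system U_α is a Feller evolution on C_b(E). -/

import Mathlib

open MeasureTheory Set

variable {E : Type*}

/-- The cumulative intensity `q(t,x) = Q(t,x,E)`. -/
noncomputable def qIntensity [MeasurableSpace E] (Q : ℝ → E → Measure E) (t : ℝ) (x : E) : ℝ :=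
  (Q t x univ).toReal

/-- The iterated kernels `P⁽ⁿ⁾(s,x;t,·)`. -/
noncomputable def Piter [MeasurableSpace E] (Q : ℝ → E → Measure E) :
    ℕ → ℝ → ℝ → E → Measure E
  | 0, s, t, x =>
      ENNReal.ofReal (Real.exp (-∫ r in s..t, qIntensity Q r x)) • Measure.dirac x
  | n + 1, s, t, x =>
      Measure.bind
        ((volume.restrict (Ioc s t)).withDensity fun r =>
          ENNReal.ofReal (Real.exp (-∫ τ in s..r, qIntensity Q τ x)))
        fun r => Measure.bind (Q r x) fun y => Piter Q n r t y

/-- The minimal transition function `P(s,x;t,·) = Σ_n P⁽ⁿ⁾(s,x;t,·)`. -/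
noncomputable def Pmin [MeasurableSpace E] (Q : ℝ → E → Measure E) (s t : ℝ) (x : E) :
    Measure E :=
  Measure.sum fun n => Piter Q n s t x

/-- The evolution system `U(s,t)F(x) = ∫_E F(y) P(s,x;t,dy)`. -/
noncomputable def Umin [MeasurableSpace E] (Q : ℝ → E → Measure E) (s t : ℝ) (F : E → ℝ)
    (x : E) : ℝ :=
  ∫ y, F y ∂(Pmin Q s t x)

/-- `Q` is a transition function. -/
def IsTransitionFunction [MeasurableSpace E] [TopologicalSpace E]
    (Q : ℝ → E → Measure E) : Prop :=
  (∀ t x, 0 ≤ t → IsFiniteMeasure (Q t x)) ∧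
  (∀ t x, 0 ≤ t → Q t x {x} = 0) ∧
  (∀ A : Set E, MeasurableSet A → Measurable fun p : ℝ × E => Q p.1 p.2 A) ∧
  (∀ T > (0 : ℝ), ∀ B : Set E, IsCompact B →
    ∃ C : ℝ, ∀ t ∈ Icc (0 : ℝ) T, ∀ x ∈ B, (Q t x univ).toReal ≤ C)

/-- The standing hypotheses (H). -/
structure StandingHypotheses [MeasurableSpace E] [TopologicalSpace E]
    (Q : ℝ → E → Measure E) (V : E → ℝ) (c : ℝ → ℝ) : Prop where
  V_cont : Continuous V
  V_nonneg : ∀ x, 0 ≤ V x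
  c_cont : Continuous c
  c_nonneg : ∀ t, 0 ≤ c t
  weak_cont : ∀ F : E → ℝ, Continuous F → (∃ M : ℝ, ∀ x, |F x| ≤ M * (1 + V x)) →
    ContinuousOn (fun p : ℝ × E => ∫ y, F y ∂(Q p.1 p.2)) {p : ℝ × E | 0 ≤ p.1}
  q_bound : ∀ T > (0 : ℝ), ∃ a > (0 : ℝ), ∀ t ∈ Icc (0 : ℝ) T, ∀ x,
    qIntensity Q t x ≤ a * V x
  lyapunov : ∀ t : ℝ, 0 ≤ t → ∀ x,
    ∫⁻ y, ENNReal.ofReal (V y) ∂(Q t x)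
      ≤ ENNReal.ofReal (c t * V x + qIntensity Q t x * V x)
  localization : ∀ ε > (0 : ℝ), ∀ B : Set E, IsCompact B → ∀ T > (0 : ℝ),
    ∃ A : Set E, IsCompact A ∧ ∀ x ∈ B, ∫ r in (0 : ℝ)..T, (Q r x Aᶜ).toReal < ε

/-- `Q` is jointly weakly continuous: `(t,x) ↦ ∫_E F(y) Q(t,x,dy)` is continuous for
every bounded continuous `F`. -/
def JointlyWeaklyContinuous [MeasurableSpace E] [TopologicalSpace E]
    (Q : ℝ → E → Measure E) : Prop :=
  ∀ F : E → ℝ, Continuous F → (∃ M : ℝ, ∀ x, |F x| ≤ M) →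
    ContinuousOn (fun p : ℝ × E => ∫ y, F y ∂(Q p.1 p.2)) {p : ℝ × E | 0 ≤ p.1}

open Filter Topology ENNReal

section WeakContinuity

variable [TopologicalSpace E] [MeasurableSpace E] [BorelSpace E] [PolishSpace E]
  [LocallyCompactSpace E]

/-- Weak continuity of a family of finite measures upgrades to joint continuity of the integrals
of integrands which depend continuously on the parameter. -/
theorem continuous_integral_of_weaklyContinuous {X : Type*} [TopologicalSpace X]
    {μ : X → Measure E} [∀ x, IsFiniteMeasure (μ x)]
    (hμ : ∀ F : E → ℝ, Continuous F → (∃ M : ℝ, ∀ y, |F y| ≤ M) →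
      Continuous fun x => ∫ y, F y ∂(μ x))
    {h : X × E → ℝ} (hc : Continuous h) {M : ℝ} (hM : ∀ p, |h p| ≤ M) :
    Continuous fun x => ∫ y, h (x, y) ∂(μ x) := by
  have hM' : ∀ p, |h p| ≤ |M| := fun p => (hM p).trans (le_abs_self M)
  have hint : ∀ x x' : X, Integrable (fun y => h (x, y)) (μ x') := fun x x' =>
    Integrable.of_bound (by fun_prop) |M| (ae_of_all _ fun y => hM' _)
  refine continuous_iff_continuousAt.2 fun x₀ => Metric.tendsto_nhds.2 fun ε hε => ?_
  set m := (μ x₀).real univ with hm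
  have hm0 : 0 ≤ m := measureReal_nonneg
  set δ := ε / (m + 2 * |M| + 2) with hδ
  have hD : 0 < m + 2 * |M| + 2 := by positivity
  have hδ0 : 0 < δ := by positivity
  obtain ⟨K, -, hK, hKδ⟩ := MeasurableSet.univ.exists_isCompact_sdiff_lt
    (measure_ne_top (μ x₀) univ) (ENNReal.ofReal_pos.2 hδ0).ne'
  obtain ⟨φ, hφ1, -, hφc, hφI⟩ :=
    exists_continuous_one_zero_of_isCompact hK isClosed_empty (disjoint_empty K)
  have hψint : ∀ x, Integrable (fun y => 1 - φ y) (μ x) := fun x =>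
    Integrable.of_bound (by fun_prop) 1 (ae_of_all _ fun y => by
      rw [Real.norm_eq_abs, abs_le]; constructor <;> linarith [(hφI y).1, (hφI y).2])
  have hψ₀ : ∫ y, (1 - φ y) ∂(μ x₀) < δ := by
    have h1 : ∫ y, (1 - φ y) ∂(μ x₀) ≤ ∫ y, Kᶜ.indicator 1 y ∂(μ x₀) := by
      refine integral_mono (hψint x₀)
        ((integrable_const (1 : ℝ)).indicator hK.measurableSet.compl) fun y => ?_
      by_cases hy : y ∈ K
      · simp [hy, hφ1 hy]
      · simpa [hy] using (hφI y).1
    rw [integral_indicator_one hK.measurableSet.compl] at h1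
    refine h1.trans_lt ?_
    rw [← compl_eq_univ_sdiff] at hKδ
    exact (ENNReal.lt_ofReal_iff_toReal_lt (measure_ne_top _ _)).1 hKδ
  have e1 : ∀ᶠ x in 𝓝 x₀, ∫ y, (1 - φ y) ∂(μ x) < δ :=
    (hμ (fun y => 1 - φ y) (by fun_prop) ⟨1, fun y => by
      rw [abs_le]; constructor <;> linarith [(hφI y).1, (hφI y).2]⟩).continuousAt.eventually_lt
      continuousAt_const hψ₀
  have e2 : ∀ᶠ x in 𝓝 x₀, ∀ y ∈ tsupport φ, |h (x, y) - h (x₀, y)| < δ := by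
    refine hφc.eventually_forall_of_forall_eventually fun y _ => ?_
    have hc' : Continuous fun z : X × E => |h (z.1, z.2) - h (x₀, z.2)| := by fun_prop
    exact hc'.continuousAt.eventually_lt continuousAt_const (by simpa using hδ0)
  have e3 : ∀ᶠ x in 𝓝 x₀, (μ x).real univ < m + 1 := by
    have := hμ (fun _ => 1) continuous_const ⟨1, fun _ => by simp⟩
    simp only [integral_const, smul_eq_mul, mul_one] at this
    exact this.continuousAt.eventually_lt continuousAt_const (by simp [hm])
  have e4 : ∀ᶠ x in 𝓝 x₀, |∫ y, h (x₀, y) ∂(μ x) - ∫ y, h (x₀, y) ∂(μ x₀)| < δ :=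
    Metric.tendsto_nhds.1
      (hμ (fun y => h (x₀, y)) (by fun_prop) ⟨M, fun y => hM _⟩).continuousAt δ hδ0
  filter_upwards [e1, e2, e3, e4] with x h1 h2 h3 h4
  have key : |∫ y, h (x, y) ∂(μ x) - ∫ y, h (x₀, y) ∂(μ x)| ≤
      δ * (μ x).real univ + 2 * |M| * ∫ y, (1 - φ y) ∂(μ x) := by
    rw [← integral_sub (hint x x) (hint x₀ x)]
    have hb : ∫ y, (δ + 2 * |M| * (1 - φ y)) ∂(μ x) =
        δ * (μ x).real univ + 2 * |M| * ∫ y, (1 - φ y) ∂(μ x) := by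
      rw [integral_add (integrable_const _) ((hψint x).const_mul _), integral_const_mul]
      simp [mul_comm]
    rw [← hb]
    change ‖∫ y, (h (x, y) - h (x₀, y)) ∂(μ x)‖ ≤ _
    refine norm_integral_le_of_norm_le
      ((integrable_const _).add ((hψint x).const_mul _)) (ae_of_all _ fun y => ?_)
    rw [Real.norm_eq_abs]
    by_cases hy : y ∈ tsupport φ
    · have : 0 ≤ 2 * |M| * (1 - φ y) :=
        mul_nonneg (by positivity) (by linarith [(hφI y).2])
      linarith [h2 y hy]
    · rw [image_eq_zero_of_notMem_tsupport hy]
      have := abs_sub (h (x, y)) (h (x₀, y))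
      linarith [hM' (x, y), hM' (x₀, y)]
  rw [Real.dist_eq]
  have hεδ : δ * (m + 2 * |M| + 2) = ε := div_mul_cancel₀ _ hD.ne'
  have t1 : δ * (μ x).real univ ≤ δ * (m + 1) := by gcongr
  have t2 : 2 * |M| * ∫ y, (1 - φ y) ∂(μ x) ≤ 2 * |M| * δ := by gcongr
  have t3 := abs_sub_le (∫ y, h (x, y) ∂(μ x)) (∫ y, h (x₀, y) ∂(μ x)) (∫ y, h (x₀, y) ∂(μ x₀))
  linarith

end WeakContinuity

section Measurability

variable [MeasurableSpace E]

/-- Iterated kernels depend on the values of `Q` at times in `(s, t]` only. -/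
theorem Piter_congr {Q Q' : ℝ → E → Measure E} (h : ∀ t, 0 ≤ t → Q t = Q' t) (n : ℕ)
    {s : ℝ} (hs : 0 ≤ s) {t : ℝ} (hst : s ≤ t) (x : E) :
    Piter Q n s t x = Piter Q' n s t x := by
  have hq : ∀ r, s ≤ r → ∫ τ in s..r, qIntensity Q τ x = ∫ τ in s..r, qIntensity Q' τ x := by
    intro r hr
    refine intervalIntegral.integral_congr fun τ hτ => ?_
    rw [uIcc_of_le hr] at hτ
    simp only [qIntensity, h τ (hs.trans hτ.1)]
  induction n generalizing s x with
  | zero => simp only [Piter, hq t hst]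
  | succ n ih =>
    have h1 : (volume.restrict (Ioc s t)).withDensity (fun r =>
          ENNReal.ofReal (Real.exp (-∫ τ in s..r, qIntensity Q τ x))) =
        (volume.restrict (Ioc s t)).withDensity (fun r =>
          ENNReal.ofReal (Real.exp (-∫ τ in s..r, qIntensity Q' τ x))) := by
      refine withDensity_congr_ae ?_
      filter_upwards [ae_restrict_mem measurableSet_Ioc] with r hr
      rw [hq r hr.1.le]
    simp only [Piter]
    rw [h1]
    refine Measure.bind_congr_right ?_
    filter_upwards [(withDensity_absolutelyContinuous _ _).ae_le
      (ae_restrict_mem measurableSet_Ioc)] with r hr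
    have hr0 : 0 ≤ r := hs.trans hr.1.le
    rw [h r hr0]
    congr 1
    funext y
    refine ih hr0 hr.2 y fun r' hr' => ?_
    refine intervalIntegral.integral_congr fun τ hτ => ?_
    rw [uIcc_of_le hr'] at hτ
    simp only [qIntensity, h τ (hr0.trans hτ.1)]

theorem Piter_succ (Q : ℝ → E → Measure E) (n : ℕ) (s t : ℝ) (x : E) :
    Piter Q (n + 1) s t x = ((volume.restrict (Ioc s t)).withDensity fun r =>
      ENNReal.ofReal (Real.exp (-∫ τ in s..r, qIntensity Q τ x))).bind
        fun r => (Q r x).bind fun y => Piter Q n r t y := rfl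

theorem measurable_map_prodMk {α β : Type*} [MeasurableSpace α] [MeasurableSpace β]
    {κ : α → Measure β} (hκ : Measurable κ) [hfin : ∀ a, IsFiniteMeasure (κ a)] :
    Measurable fun a => (κ a).map (Prod.mk a) := by
  refine Measure.measurable_of_measurable_coe _ fun A hA => ?_
  simp_rw [Measure.map_apply measurable_prodMk_left hA]
  exact ProbabilityTheory.Kernel.measurable_kernel_prodMk_left_of_finite (κ := ⟨κ, hκ⟩) hA hfin

theorem measurable_bind_of_measurable_prod {Q : ℝ → E → Measure E}
    [∀ t x, IsFiniteMeasure (Q t x)] (hQ : Measurable fun p : ℝ × E => Q p.1 p.2)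
    {P : ℝ → E → Measure E} (hP : Measurable fun p : ℝ × E => P p.1 p.2) :
    Measurable fun p : ℝ × E => (Q p.1 p.2).bind (P p.1) := by
  have h := (Measure.measurable_bind' (hP.comp
    (measurable_fst.fst.prodMk measurable_snd : Measurable fun a : (ℝ × E) × E =>
      (a.1.1, a.2)))).comp (measurable_map_prodMk hQ)
  convert h using 2 with p
  refine Measure.ext fun A hA => ?_
  have hPp : Measurable (P p.1) := hP.comp measurable_prodMk_left
  have hP' : Measurable fun a : (ℝ × E) × E => P a.1.1 a.2 :=
    hP.comp (measurable_fst.fst.prodMk measurable_snd)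
  simp only [Function.comp_def]
  rw [Measure.bind_apply hA hPp.aemeasurable, Measure.bind_apply hA hP'.aemeasurable,
    lintegral_map (f := fun a : (ℝ × E) × E => P a.1.1 a.2 A)
      ((Measure.measurable_coe hA).comp hP') measurable_prodMk_left]

end Measurability

section Regularity

variable [TopologicalSpace E] [MeasurableSpace E]

/-- A family of finite measures indexed by all real times, jointly measurable and
jointly weakly continuous. -/
structure IsWeaklyContinuousFamily (Q : ℝ → E → Measure E) : Prop where
  finite : ∀ t x, IsFiniteMeasure (Q t x)
  measurable : Measurable fun p : ℝ × E => Q p.1 p.2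
  weak_cont : ∀ F : E → ℝ, Continuous F → (∃ M : ℝ, ∀ x, |F x| ≤ M) →
    Continuous fun p : ℝ × E => ∫ y, F y ∂(Q p.1 p.2)

namespace IsWeaklyContinuousFamily

variable {Q : ℝ → E → Measure E}

theorem continuous_qIntensity (hQ : IsWeaklyContinuousFamily Q) :
    Continuous fun p : ℝ × E => qIntensity Q p.1 p.2 := by
  simpa [qIntensity, Measure.real] using
    hQ.weak_cont (fun _ => 1) continuous_const ⟨1, fun _ => by simp⟩

theorem continuous_qIntensity_left (hQ : IsWeaklyContinuousFamily Q) (x : E) :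
    Continuous fun t => qIntensity Q t x :=
  hQ.continuous_qIntensity.comp (by fun_prop : Continuous fun t : ℝ => (t, x))

theorem continuous_integral_qIntensity [FirstCountableTopology E]
    (hQ : IsWeaklyContinuousFamily Q) :
    Continuous fun p : (ℝ × ℝ) × E => ∫ r in p.1.1..p.1.2, qIntensity Q r p.2 := by
  have h0 : ∀ p : (ℝ × ℝ) × E, ∫ r in p.1.1..p.1.2, qIntensity Q r p.2 =
      (∫ r in (0 : ℝ)..p.1.2, qIntensity Q r p.2) -
        ∫ r in (0 : ℝ)..p.1.1, qIntensity Q r p.2 := fun p =>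
    (intervalIntegral.integral_interval_sub_left
      ((hQ.continuous_qIntensity_left p.2).intervalIntegrable _ _)
      ((hQ.continuous_qIntensity_left p.2).intervalIntegrable _ _)).symm
  simp_rw [h0]
  have hu : Continuous (Function.uncurry fun (p : (ℝ × ℝ) × E) (r : ℝ) => qIntensity Q r p.2) :=
    hQ.continuous_qIntensity.comp
      (by fun_prop : Continuous fun z : ((ℝ × ℝ) × E) × ℝ => (z.2, z.1.2))
  exact (intervalIntegral.continuous_parametric_intervalIntegral_of_continuous hu
    (by fun_prop)).sub
    (intervalIntegral.continuous_parametric_intervalIntegral_of_continuous hu (by fun_prop))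

/-- The survival probability `exp(-∫_s^t q(r,x) dr)` is jointly continuous. -/
theorem continuous_survival [FirstCountableTopology E] (hQ : IsWeaklyContinuousFamily Q) :
    Continuous fun p : (ℝ × ℝ) × E =>
      Real.exp (-∫ r in p.1.1..p.1.2, qIntensity Q r p.2) :=
  Real.continuous_exp.comp hQ.continuous_integral_qIntensity.neg

/-- The probability of a jump during `(s, t]` is the complement of the survival probability. -/
theorem integral_survival_mul_qIntensity (hQ : IsWeaklyContinuousFamily Q) (s t : ℝ) (x : E) :
    ∫ r in s..t, Real.exp (-∫ τ in s..r, qIntensity Q τ x) * qIntensity Q r x =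
      1 - Real.exp (-∫ τ in s..t, qIntensity Q τ x) := by
  have hc := hQ.continuous_qIntensity_left x
  have hA : ∀ r, HasDerivAt (fun r => ∫ τ in s..r, qIntensity Q τ x) (qIntensity Q r x) r :=
    fun r => hc.integral_hasStrictDerivAt s r |>.hasDerivAt
  have hd : ∀ r ∈ uIcc s t, HasDerivAt (fun r => -Real.exp (-∫ τ in s..r, qIntensity Q τ x))
      (Real.exp (-∫ τ in s..r, qIntensity Q τ x) * qIntensity Q r x) r := fun r _ => by
    have h := (hA r).fun_neg.exp.fun_neg
    rwa [mul_neg, neg_neg] at h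
  have hcA : Continuous fun r => ∫ τ in s..r, qIntensity Q τ x :=
    continuous_iff_continuousAt.2 fun r => (hA r).continuousAt
  rw [intervalIntegral.integral_eq_sub_of_hasDerivAt hd
    (Continuous.intervalIntegrable (by fun_prop) _ _)]
  simp
  ring

variable [BorelSpace E] [PolishSpace E]

theorem measurable_Piter (hQ : IsWeaklyContinuousFamily Q) (n : ℕ) (t : ℝ) :
    Measurable fun p : ℝ × E => Piter Q n p.1 t p.2 := by
  have := hQ.finite
  induction n with
  | zero =>
    refine Measure.measurable_of_measurable_coe _ fun A hA => ?_
    simp only [Piter, Measure.smul_apply, smul_eq_mul, Measure.dirac_apply' _ hA]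
    have h := hQ.continuous_survival.comp
      (by fun_prop : Continuous fun p : ℝ × E => ((p.1, t), p.2))
    exact (ENNReal.measurable_ofReal.comp h.measurable).mul
      ((measurable_one.indicator hA).comp measurable_snd)
  | succ n ih =>
    simp only [Piter_succ]
    generalize hP : (fun r y => Piter Q n r t y) = P
    replace hP : ∀ r y, Piter Q n r t y = P r y := fun r y => congrFun₂ hP r y
    simp only [hP] at ih ⊢
    have hb := measurable_bind_of_measurable_prod hQ.measurable ih
    refine Measure.measurable_of_measurable_coe _ fun A hA => ?_
    have hbA : Measurable fun p : ℝ × E => (Q p.1 p.2).bind (P p.1) A :=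
      (Measure.measurable_coe hA).comp hb
    have hs := hQ.continuous_survival.measurable.ennreal_ofReal
    have heq : ∀ p : ℝ × E, ((volume.restrict (Ioc p.1 t)).withDensity fun r =>
          ENNReal.ofReal (Real.exp (-∫ τ in p.1..r, qIntensity Q τ p.2))).bind
            (fun r => (Q r p.2).bind (P r)) A =
        ∫⁻ r, ({z : (ℝ × E) × ℝ | z.2 ∈ Ioc z.1.1 t}.indicator (fun z =>
          ENNReal.ofReal (Real.exp (-∫ τ in z.1.1..z.2, qIntensity Q τ z.1.2)) *
            (Q z.2 z.1.2).bind (P z.2) A)) (p, r) := by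
      intro p
      have hr : Measurable fun r => (Q r p.2).bind (P r) :=
        hb.comp (f := fun r : ℝ => (r, p.2)) (by fun_prop)
      have hrA : Measurable fun r => (Q r p.2).bind (P r) A := (Measure.measurable_coe hA).comp hr
      have hsr : Measurable fun r =>
          ENNReal.ofReal (Real.exp (-∫ τ in p.1..r, qIntensity Q τ p.2)) :=
        hs.comp (f := fun r : ℝ => ((p.1, r), p.2)) (by fun_prop)
      rw [Measure.bind_apply hA hr.aemeasurable,
        lintegral_withDensity_eq_lintegral_mul _ hsr hrA,
        ← lintegral_indicator measurableSet_Ioc]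
      rfl
    simp_rw [heq]
    refine Measurable.lintegral_prod_right' (Measurable.indicator (Measurable.mul ?_ ?_) ?_)
    · exact hs.comp (f := fun z : (ℝ × E) × ℝ => ((z.1.1, z.2), z.1.2)) (by fun_prop)
    · exact hbA.comp (f := fun z : (ℝ × E) × ℝ => (z.2, z.1.2)) (by fun_prop)
    · exact (measurableSet_lt measurable_fst.fst measurable_snd).inter
        (measurableSet_le measurable_snd measurable_const)

theorem lintegral_Piter_succ (hQ : IsWeaklyContinuousFamily Q) (n : ℕ) (s t : ℝ) (x : E)
    {f : E → ℝ≥0∞} (hf : Measurable f) :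
    ∫⁻ y, f y ∂(Piter Q (n + 1) s t x) =
      ∫⁻ r in Ioc s t, ENNReal.ofReal (Real.exp (-∫ τ in s..r, qIntensity Q τ x)) *
        ∫⁻ y, (∫⁻ z, f z ∂(Piter Q n r t y)) ∂(Q r x) := by
  have := hQ.finite
  have hP := hQ.measurable_Piter n t
  rw [Piter_succ]
  generalize hPn : (fun r y => Piter Q n r t y) = P
  replace hPn : ∀ r y, Piter Q n r t y = P r y := fun r y => congrFun₂ hPn r y
  simp only [hPn] at hP ⊢
  have hb : Measurable fun r => (Q r x).bind (P r) :=
    (measurable_bind_of_measurable_prod hQ.measurable hP).comp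
      (f := fun r : ℝ => (r, x)) (by fun_prop)
  have hbf : Measurable fun r => ∫⁻ y, f y ∂((Q r x).bind (P r)) :=
    (Measure.measurable_lintegral hf).comp hb
  have hsr : Measurable fun r =>
      ENNReal.ofReal (Real.exp (-∫ τ in s..r, qIntensity Q τ x)) :=
    hQ.continuous_survival.measurable.ennreal_ofReal.comp
      (f := fun r : ℝ => ((s, r), x)) (by fun_prop)
  rw [Measure.lintegral_bind hb.aemeasurable hf.aemeasurable,
    lintegral_withDensity_eq_lintegral_mul _ hsr hbf]
  refine lintegral_congr fun r => ?_
  have hPr : Measurable (P r) := hP.comp measurable_prodMk_left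
  rw [Pi.mul_apply, Measure.lintegral_bind hPr.aemeasurable hf.aemeasurable]

variable [LocallyCompactSpace E]

/-- Integrals of nonnegative bounded continuous functions against the iterated kernels extend to
jointly continuous functions with the same bound. -/
theorem exists_continuous_lintegral_Piter_eq (hQ : IsWeaklyContinuousFamily Q) {F : E → ℝ}
    (hF : Continuous F) {M : ℝ} (hF0 : ∀ x, 0 ≤ F x) (hFM : ∀ x, F x ≤ M) (n : ℕ) :
    ∃ w : (ℝ × ℝ) × E → ℝ, Continuous w ∧ (∀ p, 0 ≤ w p ∧ w p ≤ M) ∧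
      ∀ s t x, s ≤ t → ∫⁻ y, ENNReal.ofReal (F y) ∂(Piter Q n s t x) =
        ENNReal.ofReal (w ((s, t), x)) := by
  have := hQ.finite
  have hFm : Measurable fun y => ENNReal.ofReal (F y) := hF.measurable.ennreal_ofReal
  have hq0 : ∀ t x, 0 ≤ qIntensity Q t x := fun _ _ => ENNReal.toReal_nonneg
  -- Clamping `s` to `min s t` gives functions defined and continuous everywhere.
  let clamp : (ℝ × ℝ) × E → (ℝ × ℝ) × E := fun p => ((min p.1.1 p.1.2, p.1.2), p.2)
  have hclamp : Continuous clamp := by fun_prop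
  induction n with
  | zero =>
    refine ⟨fun p => Real.exp (-∫ r in (clamp p).1.1..(clamp p).1.2,
      qIntensity Q r (clamp p).2) * F p.2,
      (hQ.continuous_survival.comp hclamp).mul (by fun_prop), fun p => ⟨?_, ?_⟩, ?_⟩
    · exact mul_nonneg (Real.exp_nonneg _) (hF0 _)
    · refine (mul_le_of_le_one_left (hF0 _) ?_).trans (hFM _)
      exact Real.exp_le_one_iff.2 (neg_nonpos.2
        (intervalIntegral.integral_nonneg (min_le_right _ _) fun r _ => hq0 r _))
    · intro s t x hst
      simp only [Piter, clamp, min_eq_left hst]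
      rw [lintegral_smul_measure, lintegral_dirac' _ hFm, smul_eq_mul,
        ENNReal.ofReal_mul (Real.exp_nonneg _)]
  | succ n ih =>
    obtain ⟨w, hwc, hwb, hw⟩ := ih
    have hwint : ∀ r t x, Integrable (fun y => w ((r, t), y)) (Q r x) := fun r t x =>
      Integrable.of_bound (by fun_prop) M (ae_of_all _ fun y => by
        rw [Real.norm_eq_abs, abs_of_nonneg (hwb _).1]; exact (hwb _).2)
    let G : (ℝ × ℝ) × E → ℝ := fun p => ∫ y, w (p.1, y) ∂(Q p.1.1 p.2)
    have hGc : Continuous G := by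
      have hμ : ∀ p : (ℝ × ℝ) × E, IsFiniteMeasure (Q p.1.1 p.2) := fun p => this _ _
      refine continuous_integral_of_weaklyContinuous (μ := fun p : (ℝ × ℝ) × E => Q p.1.1 p.2)
        (h := fun z : ((ℝ × ℝ) × E) × E => w (z.1.1, z.2)) (M := M) (fun F hF hFb => ?_)
        (by fun_prop) fun z => ?_
      · exact (hQ.weak_cont F hF hFb).comp
          (by fun_prop : Continuous fun p : (ℝ × ℝ) × E => (p.1.1, p.2))
      · rw [abs_of_nonneg (hwb _).1]; exact (hwb _).2
    have hG0 : ∀ p, 0 ≤ G p := fun p => integral_nonneg fun y => (hwb _).1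
    have hGM : ∀ p, G p ≤ M * qIntensity Q p.1.1 p.2 := fun p => by
      have := integral_mono (hwint p.1.1 p.1.2 p.2) (integrable_const M) fun y => (hwb _).2
      simpa [qIntensity, Measure.real, mul_comm] using this
    let H : (ℝ × ℝ) × E → ℝ → ℝ := fun p r =>
      Real.exp (-∫ τ in p.1.1..r, qIntensity Q τ p.2) * G ((r, p.1.2), p.2)
    have hHc : Continuous (Function.uncurry H) :=
      (hQ.continuous_survival.comp
        (by fun_prop : Continuous fun z : ((ℝ × ℝ) × E) × ℝ => ((z.1.1.1, z.2), z.1.2))).mul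
      (hGc.comp
        (by fun_prop : Continuous fun z : ((ℝ × ℝ) × E) × ℝ => ((z.2, z.1.1.2), z.1.2)))
    have hHp : ∀ p, Continuous (H p) := fun p => hHc.comp (by fun_prop : Continuous (Prod.mk p))
    have hH0 : ∀ p r, 0 ≤ H p r := fun p r => mul_nonneg (Real.exp_nonneg _) (hG0 _)
    let W : (ℝ × ℝ) × E → ℝ := fun p => ∫ r in p.1.1..p.1.2, H p r
    have hWc : Continuous W := by
      have : W = fun p => (∫ r in (0 : ℝ)..p.1.2, H p r) - ∫ r in (0 : ℝ)..p.1.1, H p r :=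
        funext fun p => (intervalIntegral.integral_interval_sub_left
          ((hHp p).intervalIntegrable _ _) ((hHp p).intervalIntegrable _ _)).symm
      rw [this]
      exact (intervalIntegral.continuous_parametric_intervalIntegral_of_continuous hHc
        (by fun_prop)).sub
        (intervalIntegral.continuous_parametric_intervalIntegral_of_continuous hHc
        (by fun_prop))
    have hWM : ∀ s t x, s ≤ t → W ((s, t), x) ≤ M := fun s t x hst => by
      have hM0 : 0 ≤ M := (hF0 x).trans (hFM x)
      have hcs : Continuous fun r =>
          Real.exp (-∫ τ in s..r, qIntensity Q τ x) * qIntensity Q r x :=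
        (hQ.continuous_survival.comp
          (by fun_prop : Continuous fun r : ℝ => ((s, r), x))).mul
          (hQ.continuous_qIntensity_left x)
      calc W ((s, t), x)
          ≤ ∫ r in s..t, M * (Real.exp (-∫ τ in s..r, qIntensity Q τ x) * qIntensity Q r x) := by
            refine intervalIntegral.integral_mono_on hst ((hHp _).intervalIntegrable _ _)
              ((hcs.const_mul M).intervalIntegrable _ _) fun r _ => ?_
            rw [mul_left_comm]
            exact mul_le_mul_of_nonneg_left (hGM _) (Real.exp_nonneg _)
        _ = M * (1 - Real.exp (-∫ τ in s..t, qIntensity Q τ x)) := by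
            rw [intervalIntegral.integral_const_mul, hQ.integral_survival_mul_qIntensity]
        _ ≤ M := mul_le_of_le_one_right hM0 (sub_le_self _ (Real.exp_nonneg _))
    refine ⟨W ∘ clamp, hWc.comp hclamp, fun p => ⟨?_, ?_⟩, fun s t x hst => ?_⟩
    · exact intervalIntegral.integral_nonneg (min_le_right _ _) fun r _ => hH0 _ r
    · exact hWM _ _ _ (min_le_right _ _)
    · rw [hQ.lintegral_Piter_succ n s t x hFm]
      have hcl : clamp ((s, t), x) = ((s, t), x) := by simp only [clamp, min_eq_left hst]
      rw [Function.comp_apply, hcl]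
      simp only [W]
      rw [intervalIntegral.integral_of_le hst, ofReal_integral_eq_lintegral_ofReal
        ((hHp _).intervalIntegrable s t).1 (ae_of_all _ fun r => hH0 _ r)]
      refine setLIntegral_congr_fun measurableSet_Ioc fun r hr => ?_
      simp only [H, G]
      rw [ENNReal.ofReal_mul (Real.exp_nonneg _), ofReal_integral_eq_lintegral_ofReal
        (hwint r t x) (ae_of_all _ fun y => (hwb _).1)]
      congr 1
      exact lintegral_congr fun y => hw r t y hr.2

theorem Piter_univ_le_one (hQ : IsWeaklyContinuousFamily Q) (n : ℕ) {s t : ℝ} (hst : s ≤ t)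
    (x : E) : Piter Q n s t x univ ≤ 1 := by
  obtain ⟨w, -, hwb, hw⟩ := hQ.exists_continuous_lintegral_Piter_eq (F := fun _ => 1)
    continuous_const (M := 1) (fun _ => zero_le_one) (fun _ => le_rfl) n
  have := hw s t x hst
  simp only [ENNReal.ofReal_one, lintegral_one] at this
  rw [this]
  exact ENNReal.ofReal_le_one.2 (hwb _).2

theorem continuousOn_integral_Piter (hQ : IsWeaklyContinuousFamily Q) {F : E → ℝ}
    (hF : Continuous F) {M : ℝ} (hFM : ∀ x, |F x| ≤ M) (n : ℕ) :
    ContinuousOn (fun p : (ℝ × ℝ) × E => ∫ y, F y ∂(Piter Q n p.1.1 p.1.2 p.2))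
      {p | p.1.1 ≤ p.1.2} := by
  obtain ⟨u, huc, hub, hu⟩ := hQ.exists_continuous_lintegral_Piter_eq
    (F := fun y => max (F y) 0) (M := |M|) (by fun_prop) (fun _ => le_max_right _ _)
    (fun y => max_le ((le_abs_self _).trans ((hFM y).trans (le_abs_self M))) (abs_nonneg M)) n
  obtain ⟨v, hvc, hvb, hv⟩ := hQ.exists_continuous_lintegral_Piter_eq
    (F := fun y => max (-F y) 0) (M := |M|) (by fun_prop) (fun _ => le_max_right _ _)
    (fun y => max_le ((neg_le_abs _).trans ((hFM y).trans (le_abs_self M))) (abs_nonneg M)) n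
  refine (huc.sub hvc).continuousOn.congr fun p hp => ?_
  have : IsFiniteMeasure (Piter Q n p.1.1 p.1.2 p.2) :=
    ⟨(hQ.Piter_univ_le_one n hp p.2).trans_lt ENNReal.one_lt_top⟩
  have hint : Integrable F (Piter Q n p.1.1 p.1.2 p.2) :=
    Integrable.of_bound (by fun_prop) M (ae_of_all _ hFM)
  have hup := hu _ _ p.2 hp
  have hvp := hv _ _ p.2 hp
  simp only [ENNReal.ofReal_max, ENNReal.ofReal_zero, max_zero] at hup hvp
  simp only [integral_eq_lintegral_pos_part_sub_lintegral_neg_part hint, hup, hvp,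
    ENNReal.toReal_ofReal (hub _).1, ENNReal.toReal_ofReal (hvb _).1, Pi.sub_apply]

theorem abs_integral_Piter_le (hQ : IsWeaklyContinuousFamily Q) {F : E → ℝ}
    {M : ℝ} (hFM : ∀ x, |F x| ≤ M) (n : ℕ) {s t : ℝ} (hst : s ≤ t) (x : E) :
    |∫ y, F y ∂(Piter Q n s t x)| ≤ M := by
  have hP := hQ.Piter_univ_le_one n hst x
  have : IsFiniteMeasure (Piter Q n s t x) := ⟨hP.trans_lt ENNReal.one_lt_top⟩
  refine (norm_integral_le_of_norm_le_const (C := M) (f := F) (ae_of_all _ hFM)).trans ?_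
  exact mul_le_of_le_one_right ((abs_nonneg _).trans (hFM x))
    (ENNReal.toReal_le_of_le_ofReal zero_le_one (by simpa using hP))

end IsWeaklyContinuousFamily

/-- Freezing a jointly weakly continuous transition function at negative times. -/
theorem IsTransitionFunction.isWeaklyContinuousFamily {Q : ℝ → E → Measure E}
    (hQ : IsTransitionFunction Q) (hw : JointlyWeaklyContinuous Q) :
    IsWeaklyContinuousFamily fun t => Q (max t 0) where
  finite t x := hQ.1 _ x (le_max_right _ _)
  measurable := (Measure.measurable_of_measurable_coe _ fun A hA => hQ.2.2.1 A hA).comp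
    ((measurable_fst.max measurable_const).prodMk measurable_snd)
  weak_cont F hF hFb := (hw F hF hFb).comp_continuous
    (by fun_prop : Continuous fun p : ℝ × E => (max p.1 0, p.2)) fun p => le_max_right p.1 0

end Regularity

/-- For a jointly weakly continuous transition function `Q` and
`α ∈ (0,1)`, the series `U_α(s,t)F(x) = Σ_n αⁿ U⁽ⁿ⁾(s,t)F(x)` converges uniformly in
`(s,t,x)` and defines a continuous function on `{(s,t) : 0 ≤ s ≤ t} × E`;
i.e. `U_α` is a Feller evolution on `C_b(E)`. -/
theorem regularized_evolution_feller [MeasurableSpace E] [TopologicalSpace E] [BorelSpace E]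
    [PolishSpace E] [LocallyCompactSpace E]
    (Q : ℝ → E → Measure E) (hQ : IsTransitionFunction Q)
    (hw : JointlyWeaklyContinuous Q)
    (α : ℝ) (hα : α ∈ Ioo (0 : ℝ) 1)
    (F : E → ℝ) (hFc : Continuous F) (hFb : ∃ M : ℝ, ∀ x, |F x| ≤ M) :
    TendstoUniformlyOn
      (fun N (p : (ℝ × ℝ) × E) =>
        ∑ n ∈ Finset.range N, α ^ n * ∫ y, F y ∂(Piter Q n p.1.1 p.1.2 p.2))
      (fun p : (ℝ × ℝ) × E => ∑' n : ℕ, α ^ n * ∫ y, F y ∂(Piter Q n p.1.1 p.1.2 p.2))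
      Filter.atTop {p : (ℝ × ℝ) × E | 0 ≤ p.1.1 ∧ p.1.1 ≤ p.1.2} ∧
    ContinuousOn
      (fun p : (ℝ × ℝ) × E => ∑' n : ℕ, α ^ n * ∫ y, F y ∂(Piter Q n p.1.1 p.1.2 p.2))
      {p : (ℝ × ℝ) × E | 0 ≤ p.1.1 ∧ p.1.1 ≤ p.1.2} := by
  obtain ⟨M, hM⟩ := hFb
  have hQ' := hQ.isWeaklyContinuousFamily hw
  have hP : ∀ n, ∀ p ∈ {p : (ℝ × ℝ) × E | 0 ≤ p.1.1 ∧ p.1.1 ≤ p.1.2},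
      Piter Q n p.1.1 p.1.2 p.2 = Piter (fun t => Q (max t 0)) n p.1.1 p.1.2 p.2 :=
    fun n p hp => Piter_congr (fun t ht => by simp only [max_eq_left ht]) n hp.1 hp.2 p.2
  have hsum : Summable fun n : ℕ => α ^ n * M :=
    (summable_geometric_of_lt_one hα.1.le hα.2).mul_right M
  have hbound : ∀ n, ∀ p ∈ {p : (ℝ × ℝ) × E | 0 ≤ p.1.1 ∧ p.1.1 ≤ p.1.2},
      ‖α ^ n * ∫ y, F y ∂(Piter Q n p.1.1 p.1.2 p.2)‖ ≤ α ^ n * M := by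
    intro n p hp
    have hαn : 0 ≤ α ^ n := pow_nonneg hα.1.le n
    rw [norm_mul, Real.norm_of_nonneg hαn, hP n p hp]
    exact mul_le_mul_of_nonneg_left (hQ'.abs_integral_Piter_le hM n hp.2 p.2) hαn
  refine ⟨tendstoUniformlyOn_tsum_nat hsum hbound, continuousOn_tsum (fun n => ?_) hsum hbound⟩
  refine continuousOn_const.mul (((hQ'.continuousOn_integral_Piter hFc hM n).mono
    fun p hp => hp.2).congr fun p hp => ?_)
  rw [hP n p hp]
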